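/- (Classification of self-dual antinorms in the plane, necessity.) Let f be a continuous self-dual antinorm on ℝ²₊, and let a be the (unique) vector with a ∈ ℝ²₊, |a| = 1 and f(a) = 1. Set K₁ = {x ∈ ℝ²₊ : a₁x₂ − a₂x₁ ≥ 0} and K₂ = {x ∈ ℝ²₊ : a₁x₂ − a₂x₁ ≤ 0}. Then f(x) ≤ ⟨a,x⟩ for all x ∈ ℝ²₊, and for every y ∈ K₂ one has f(y) = inf{⟨x,y⟩/f(x) : x ∈ K₁, f(x) ≠ 0}; i.e., f arises from its restriction to K₁ by the duality construction. -/

import Mathlib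

open scoped BigOperators

noncomputable section

/-- The positive orthant in Euclidean space `ℝ^d`. -/
def pos (d : ℕ) : Set (EuclideanSpace ℝ (Fin d)) := {x | ∀ i, 0 ≤ x i}

/-- Euclidean inner product of two vectors. -/
def dot {d : ℕ} (p x : EuclideanSpace ℝ (Fin d)) : ℝ := ∑ i, p i * x i

/-- An antinorm on a set `K`: nonnegative, positively homogeneous, concave on `K`
and strictly positive somewhere on `K`. -/
def IsAntinormOn {d : ℕ} (K : Set (EuclideanSpace ℝ (Fin d)))
    (f : EuclideanSpace ℝ (Fin d) → ℝ) : Prop :=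
  (∀ x ∈ K, 0 ≤ f x) ∧
  (∀ x ∈ K, ∀ l : ℝ, 0 ≤ l → f (l • x) = l * f x) ∧
  ConcaveOn ℝ K f ∧
  ∃ x ∈ K, 0 < f x

/-- An antinorm on the positive orthant. -/
def IsAntinorm {d : ℕ} (f : EuclideanSpace ℝ (Fin d) → ℝ) : Prop :=
  IsAntinormOn (pos d) f

/-- The dual antinorm `f*(p) = inf {⟨p,x⟩/f(x) : x ∈ ℝ^d₊, f(x) ≠ 0}`. -/
def dualAntinorm {d : ℕ} (f : EuclideanSpace ℝ (Fin d) → ℝ)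
    (p : EuclideanSpace ℝ (Fin d)) : ℝ :=
  sInf ((fun x => dot p x / f x) '' {x | x ∈ pos d ∧ f x ≠ 0})

/-- The part of `ℝ²₊` on one side of the ray through `a`. -/
def K1 (a : EuclideanSpace ℝ (Fin 2)) : Set (EuclideanSpace ℝ (Fin 2)) :=
  {x ∈ pos 2 | 0 ≤ a 0 * x 1 - a 1 * x 0}

/-- The part of `ℝ²₊` on the other side of the ray through `a`. -/
def K2 (a : EuclideanSpace ℝ (Fin 2)) : Set (EuclideanSpace ℝ (Fin 2)) :=
  {x ∈ pos 2 | a 0 * x 1 - a 1 * x 0 ≤ 0}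

theorem dot_two (p x : EuclideanSpace ℝ (Fin 2)) : dot p x = p 0 * x 0 + p 1 * x 1 := by
  simp [dot, Fin.sum_univ_two]

theorem dot_nonneg {d : ℕ} {p x : EuclideanSpace ℝ (Fin d)} (hp : p ∈ pos d) (hx : x ∈ pos d) :
    0 ≤ dot p x :=
  Finset.sum_nonneg fun i _ => mul_nonneg (hp i) (hx i)

theorem dualAntinorm_le_div {d : ℕ} {f : EuclideanSpace ℝ (Fin d) → ℝ}
    (hf : ∀ x ∈ pos d, 0 ≤ f x) {p x : EuclideanSpace ℝ (Fin d)}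
    (hp : p ∈ pos d) (hx : x ∈ pos d) (hfx : f x ≠ 0) :
    dualAntinorm f p ≤ dot p x / f x := by
  refine csInf_le ⟨0, ?_⟩ ⟨x, ⟨hx, hfx⟩, rfl⟩
  rintro _ ⟨z, hz, rfl⟩
  exact div_nonneg (dot_nonneg hp hz.1) (hf z hz.1)

/-- For a unit vector `a` of the plane, the product of the orthogonal components of `x` and `y`
is what `⟨x,y⟩` adds to `⟨a,x⟩⟨a,y⟩`; it is nonnegative on `K2 a`. -/
theorem dot_mul_dot_le_of_mem_K2 {a x y : EuclideanSpace ℝ (Fin 2)} (hna : ‖a‖ = 1)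
    (hx : x ∈ K2 a) (hy : y ∈ K2 a) : dot a x * dot a y ≤ dot x y := by
  have ha : a 0 ^ 2 + a 1 ^ 2 = 1 := by
    simpa [Fin.sum_univ_two, hna] using (EuclideanSpace.real_norm_sq_eq a).symm
  have h := mul_nonneg_of_nonpos_of_nonpos hx.2 hy.2
  simp only [dot_two]
  linear_combination h + (x 0 * y 0 + x 1 * y 1) * ha

/-- Classification of self-dual antinorms in the plane (necessity): a continuous
self-dual antinorm `f` on `ℝ²₊`, with `a ∈ ℝ²₊`, `|a| = 1`, `f(a) = 1`, satisfies
`f(x) ≤ ⟨a,x⟩` on `ℝ²₊`, and on `K₂` it is recovered from its restriction to `K₁`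
by the duality construction. -/
theorem classification_self_dual_antinorm_plane
    (f : EuclideanSpace ℝ (Fin 2) → ℝ)
    (hf : IsAntinorm f) (hc : ContinuousOn f (pos 2))
    (hsd : ∀ p ∈ pos 2, dualAntinorm f p = f p)
    (a : EuclideanSpace ℝ (Fin 2)) (ha : a ∈ pos 2) (hna : ‖a‖ = 1)
    (hfa : f a = 1) :
    (∀ x ∈ pos 2, f x ≤ dot a x) ∧
    ∀ y ∈ K2 a, f y =
      sInf ((fun x => dot x y / f x) '' {x | x ∈ K1 a ∧ f x ≠ 0}) := by
  have hf0 := hf.1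
  have hle : ∀ x ∈ pos 2, f x ≤ dot a x := fun x hx => by
    have h := dualAntinorm_le_div hf0 hx ha (by simp [hfa])
    rwa [hsd x hx, hfa, div_one, dot_two, mul_comm (x 0), mul_comm (x 1), ← dot_two] at h
  refine ⟨hle, fun y hy => ?_⟩
  have hdot (x : EuclideanSpace ℝ (Fin 2)) : dot y x = dot x y := by
    simp only [dot, mul_comm]
  have haK : a ∈ K1 a ∧ f a ≠ 0 := ⟨⟨ha, by simp [mul_comm]⟩, by simp [hfa]⟩
  have hlower : ∀ x ∈ pos 2, f x ≠ 0 → f y ≤ dot x y / f x := fun x hx hfx => by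
    rw [← hsd y hy.1, ← hdot]
    exact dualAntinorm_le_div hf0 hy.1 hx hfx
  have hbdd : BddBelow ((fun x => dot x y / f x) '' {x | x ∈ K1 a ∧ f x ≠ 0}) := by
    refine ⟨f y, ?_⟩
    rintro _ ⟨x, hx, rfl⟩
    exact hlower x hx.1.1 hx.2
  apply le_antisymm
  · refine le_csInf ⟨_, a, haK, rfl⟩ ?_
    rintro _ ⟨x, hx, rfl⟩
    exact hlower x hx.1.1 hx.2
  · conv_rhs => rw [← hsd y hy.1]
    refine le_csInf ⟨_, a, ⟨ha, haK.2⟩, rfl⟩ ?_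
    rintro _ ⟨x, ⟨hx, hfx⟩, rfl⟩
    simp only [hdot]
    rcases le_total 0 (a 0 * x 1 - a 1 * x 0) with h | h
    · exact csInf_le hbdd ⟨x, ⟨⟨hx, h⟩, hfx⟩, rfl⟩
    · refine (csInf_le hbdd ⟨a, haK, rfl⟩).trans ?_
      have hpos : 0 < f x := lt_of_le_of_ne (hf0 x hx) hfx.symm
      simp only [hfa, div_one]
      rw [le_div_iff₀ hpos, mul_comm]
      exact (mul_le_mul_of_nonneg_right (hle x hx) (dot_nonneg ha hy.1)).trans
        (dot_mul_dot_le_of_mem_K2 hna ⟨hx, h⟩ hy)
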